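/- Let n ≥ 1 and let T : (ℤ/2)^n → {1, ..., 2^n} be the bijection as above. Define F on vectors b with b_{n−1} = 0 as follows: if b_{n−2} = 0, Fb = (1, b₀, ..., b_{n−3}, 0); if b_{n−2} = 1, Fb = (0, 1−b₀, ..., 1−b_{n−3}, 1). Then whenever T(b) is even (equivalently, b_{n−1} = 0), we have T(Fb) = T(b)/2. -/

import Mathlib

theorem sum_two_pow_sub_add_two (m : ℕ) : ∑ j : Fin m, 2 ^ (m - (j : ℕ)) + 2 = 2 ^ (m + 1) := by
  induction m with
  | zero => simp
  | succ m ih =>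
    rw [Fin.sum_univ_succ]
    simp only [Fin.val_zero, Fin.val_succ, Nat.add_sub_add_right, Nat.sub_zero]
    rw [add_assoc, ih]
    ring

/-- A binary sum and its complement add up to the full geometric sum. -/
theorem sum_two_pow_mul_add_sum_compl (m : ℕ) (d : Fin m → Fin 2) :
    ∑ j : Fin m, 2 ^ (m - (j : ℕ)) * (d j : ℕ) +
      ∑ j : Fin m, 2 ^ (m - (j : ℕ)) * ((1 - d j : Fin 2) : ℕ) + 2 = 2 ^ (m + 1) := by
  rw [← sum_two_pow_sub_add_two m, ← Finset.sum_add_distrib]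
  congr 1
  refine Finset.sum_congr rfl fun j _ => ?_
  have h : ∀ x : Fin 2, (x : ℕ) + ((1 - x : Fin 2) : ℕ) = 1 := by decide
  rw [← mul_add, h, mul_one]

/-- The sum of all but the last term, with the first term split off. -/
theorem sum_ite_eq_head_add (m : ℕ) (c : Fin (m + 2) → Fin 2) :
    (∑ k : Fin (m + 2), if (k : ℕ) < m + 2 - 1 then
        2 ^ (m + 2 - 1 - (k : ℕ)) * (c k : ℕ) else 0) =
      2 ^ (m + 1) * (c 0 : ℕ) +
        ∑ j : Fin m, 2 ^ (m - (j : ℕ)) * (c j.castSucc.succ : ℕ) := by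
  rw [Fin.sum_univ_succ, Fin.sum_univ_castSucc]
  simp

/-- The sum of all but the last term, with the last remaining term split off. -/
theorem sum_ite_eq_two_mul_add (m : ℕ) (c : Fin (m + 2) → Fin 2) :
    (∑ k : Fin (m + 2), if (k : ℕ) < m + 2 - 1 then
        2 ^ (m + 2 - 1 - (k : ℕ)) * (c k : ℕ) else 0) =
      2 * (∑ j : Fin m, 2 ^ (m - (j : ℕ)) * (c j.castSucc.castSucc : ℕ)) +
        2 * (c (Fin.last m).castSucc : ℕ) := by
  rw [Fin.sum_univ_castSucc, Fin.sum_univ_castSucc, Finset.mul_sum]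
  have h (j : Fin m) : m + 1 - (j : ℕ) = m - j + 1 := by omega
  have h' (j : Fin m) : (j : ℕ) < m + 1 := by omega
  simp [h, h', pow_succ, mul_comm, mul_left_comm]


/-- The Frobenius operation on binary vectors corresponds, via the bijection T,
to division by 2 whenever T(b) is even (i.e. b_{n-1} = 0). -/
theorem stmt_19 (n : ℕ) (hn : 1 ≤ n) (b : Fin n → Fin 2) :
    let S : (Fin n → Fin 2) → ℕ := fun c =>
      ∑ k : Fin n, if (k : ℕ) < n - 1 then 2 ^ (n - 1 - (k : ℕ)) * ((c k : ℕ)) else 0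
    let T : (Fin n → Fin 2) → ℕ := fun c =>
      if c ⟨n - 1, by omega⟩ = 1 then S c + 1 else 2 ^ n - S c
    let Fb : Fin n → Fin 2 := fun k =>
      if h1 : (k : ℕ) = 0 then (if b ⟨n - 2, by omega⟩ = 0 then 1 else 0)
      else if h2 : (k : ℕ) = n - 1 then (if b ⟨n - 2, by omega⟩ = 0 then 0 else 1)
      else if b ⟨n - 2, by omega⟩ = 0 then
        b ⟨(k : ℕ) - 1, by have := k.isLt; omega⟩
      else 1 - b ⟨(k : ℕ) - 1, by have := k.isLt; omega⟩
    b ⟨n - 1, by omega⟩ = 0 → T Fb = T b / 2 := by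
  intro S T Fb hb
  obtain _ | _ | m := n
  · omega
  · have h0 : b 0 = 0 := hb
    simp [T, S, Fb, h0]
  set d : Fin m → Fin 2 := fun j => b j.castSucc.castSucc with hd
  have hA := sum_two_pow_mul_add_sum_compl m d
  have hSb : S b = _ := sum_ite_eq_two_mul_add m b
  have hSF : S Fb = _ := sum_ite_eq_head_add m Fb
  have hTb : T b = 2 ^ (m + 2) - S b := by
    simp only [T]
    rw [if_neg (by rw [hb]; decide)]
  have hp : 2 ^ (m + 2) = 2 * 2 ^ (m + 1) := pow_succ' 2 (m + 1)
  have key : b (Fin.last m).castSucc = 0 ∨ b (Fin.last m).castSucc = 1 := by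
    generalize b (Fin.last m).castSucc = x
    revert x
    decide
  rcases key with h | h
  · have hm : b ⟨m, by omega⟩ = 0 := h
    have hF0 : Fb 0 = 1 := by simp [Fb, hm]
    have hFl : Fb ⟨m + 1 + 1 - 1, by omega⟩ = 0 := by simp [Fb, hm]
    have hFm (j : Fin m) : Fb j.castSucc.succ = d j := by
      have hj : (j : ℕ) ≠ m := j.isLt.ne
      simp [Fb, hm, hj, d]
      rfl
    have hTF : T Fb = 2 ^ (m + 2) - S Fb := by
      simp only [T]
      rw [if_neg (by rw [hFl]; decide)]
    simp only [hFm, hF0, Fin.val_one] at hSF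
    simp only [h, Fin.val_zero] at hSb
    simp only [hd] at hA hSF
    rw [hTF, hTb, hSF, hSb]
    omega
  · have hm : b ⟨m, by omega⟩ = 1 := h
    have hF0 : Fb 0 = 0 := by simp [Fb, hm]
    have hFl : Fb ⟨m + 1 + 1 - 1, by omega⟩ = 1 := by simp [Fb, hm]
    have hFm (j : Fin m) : Fb j.castSucc.succ = 1 - d j := by
      have hj : (j : ℕ) ≠ m := j.isLt.ne
      simp [Fb, hm, hj, d]
      rfl
    have hTF : T Fb = S Fb + 1 := by
      simp only [T]
      rw [if_pos hFl]
    simp only [hFm, hF0, Fin.val_zero] at hSF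
    simp only [h, Fin.val_one] at hSb
    simp only [hd] at hA hSF
    rw [hTF, hTb, hSF, hSb]
    omega
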